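/- arXiv:1806.05319 — 8 statements merged into one kernel-verified Lean document; each statement's English description precedes it below -/
import Mathlib

section
/- Let μ > 0 and α > 0, and let u be a mode solution with initial data u(0) = x and u'(0) = y (x, y ∈ ℝ). Then for every t ≥ 0 one has the exact energy identity μ·α·u(t)² + (μ·u'(t) + u(t))² + 2α·∫₀ᵗ u(s)² ds = μ·α·x² + (μ·y + x)². -/
open MeasureTheory Set

/-- A *mode solution* with parameters `μ`, `α`: a twice continuously differentiable
function `u : [0,∞) → ℝ` satisfying `μ·u'' + u' + α·u = 0` on `[0,∞)`. -/
def IsModeSolution (μ α : ℝ) (u u' u'' : ℝ → ℝ) : Prop :=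
  (∀ t ∈ Set.Ici (0:ℝ), HasDerivWithinAt u (u' t) (Set.Ici 0) t) ∧
  (∀ t ∈ Set.Ici (0:ℝ), HasDerivWithinAt u' (u'' t) (Set.Ici 0) t) ∧
  ContinuousOn u'' (Set.Ici 0) ∧
  (∀ t ∈ Set.Ici (0:ℝ), μ * u'' t + u' t + α * u t = 0)

/-- Second energy identity for a single mode of the damped wave equation. -/
theorem second_energy_identity (μ α : ℝ) (hμ : 0 < μ) (hα : 0 < α)
    (u u' u'' : ℝ → ℝ) (hu : IsModeSolution μ α u u' u'')
    (x y : ℝ) (hx : u 0 = x) (hy : u' 0 = y) :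
    ∀ t ≥ (0:ℝ),
      μ * α * (u t) ^ 2 + (μ * u' t + u t) ^ 2 + 2 * α * ∫ s in (0:ℝ)..t, (u s) ^ 2 =
        μ * α * x ^ 2 + (μ * y + x) ^ 2 := by
  intro t ht
  obtain ⟨hu₁, hu₂, -, hode⟩ := hu
  have hE : ∀ s ∈ Set.Ici (0:ℝ), HasDerivWithinAt
      (fun s => μ * α * (u s) ^ 2 + (μ * u' s + u s) ^ 2) (-(2 * α) * (u s) ^ 2) (Set.Ici 0) s := by
    intro s hs
    have h₁ := hu₁ s hs
    have h₂ := hu₂ s hs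
    refine (((h₁.pow 2).const_mul (μ * α)).add
      (((h₂.const_mul μ).add h₁).pow 2)).congr_deriv ?_
    simp only [Pi.add_apply]
    push_cast
    linear_combination 2 * (μ * u' s + u s) * hode s hs
  have hsub : Set.Icc 0 t ⊆ Set.Ici (0:ℝ) := Set.Icc_subset_Ici_self
  have hcont : ContinuousOn u (Set.Icc 0 t) := fun s hs =>
    (hu₁ s (hsub hs)).continuousWithinAt.mono hsub
  have hftc := intervalIntegral.integral_eq_sub_of_hasDerivAt_of_le ht
    (fun s hs => (hE s (hsub hs)).continuousWithinAt.mono hsub)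
    (fun s hs => (hE s hs.1.le).hasDerivAt (Ici_mem_nhds hs.1))
    (ContinuousOn.intervalIntegrable_of_Icc ht (continuousOn_const.mul (hcont.pow 2)))
  rw [intervalIntegral.integral_const_mul] at hftc
  subst hx hy
  linear_combination -hftc
end

section
/- For every μ > 0 and every a₀ > 0 there exists a constant c > 0 (depending only on μ and a₀) such that for every α ≥ a₀ and every mode solution u (with parameters μ, α), one has ∫₀^∞ (α·u(t)² + u'(t)²) dt ≤ c·(α·u(0)² + u'(0)²). -/
open MeasureTheory Set

/-- A nonnegative Lyapunov function `V` with dissipation rate `g ≥ 0` on `[0,∞)` bounds the total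
dissipation by its initial value. -/
lemma lintegral_dissipation_le {V g : ℝ → ℝ}
    (hV : ∀ t ∈ Ici (0:ℝ), HasDerivWithinAt V (-g t) (Ici 0) t)
    (hg : ∀ t ∈ Ici (0:ℝ), 0 ≤ g t) (hV0 : ∀ t, 0 ≤ V t) :
    ∫⁻ t in Ioi (0:ℝ), ENNReal.ofReal (g t) ≤ ENNReal.ofReal (V 0) := by
  have hderiv : ∀ t ∈ Ioi (0:ℝ), HasDerivAt V (-g t) t := fun t ht =>
    (hV t (Ioi_subset_Ici_self ht)).hasDerivAt (Ici_mem_nhds ht)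
  have hanti : AntitoneOn V (Ici 0) := by
    refine antitoneOn_of_hasDerivWithinAt_nonpos (f' := fun t => -g t) (convex_Ici 0)
      (fun t ht => (hV t ht).continuousWithinAt) (fun t ht => ?_) (fun t ht => ?_)
    · exact (hV t (interior_subset ht)).mono interior_subset
    · exact neg_nonpos.2 (hg t (interior_subset ht))
  have hanti_ext : Antitone fun t => V (max t 0) := fun s t hst =>
    hanti (le_max_right s 0) (le_max_right t 0) (max_le_max_right 0 hst)
  have hbdd : BddBelow (range fun t => V (max t 0)) :=
    ⟨0, by rintro _ ⟨t, rfl⟩; exact hV0 _⟩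
  obtain ⟨l, hl⟩ : ∃ l, Filter.Tendsto V Filter.atTop (nhds l) := by
    refine ⟨_, (tendsto_atTop_ciInf hanti_ext hbdd).congr' ?_⟩
    filter_upwards [Filter.eventually_ge_atTop (0:ℝ)] with t ht
    rw [max_eq_left ht]
  have hl0 : 0 ≤ l := ge_of_tendsto' hl hV0
  have hcont : ContinuousWithinAt V (Ici 0) 0 := (hV 0 self_mem_Ici).continuousWithinAt
  have hneg : ∀ t ∈ Ioi (0:ℝ), -g t ≤ 0 := fun t ht => neg_nonpos.2 (hg t (Ioi_subset_Ici_self ht))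
  have hint : IntegrableOn g (Ioi 0) := by
    simpa using (integrableOn_Ioi_deriv_of_nonpos hcont hderiv hneg hl).neg
  have hval := integral_Ioi_of_hasDerivAt_of_nonpos hcont hderiv hneg hl
  rw [integral_neg] at hval
  rw [← ofReal_integral_eq_lintegral_ofReal hint
    (ae_restrict_of_forall_mem measurableSet_Ioi fun t ht => hg t (Ioi_subset_Ici_self ht))]
  exact ENNReal.ofReal_le_ofReal (by linarith)

/-- A Lyapunov function for `μ·u'' + u' + α·u = 0` (with `v = u'`), dissipating exactly
`α·u² + v²`. -/
noncomputable def modeLyapunov (μ α u v : ℝ) : ℝ :=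
  (1 + μ) / 2 * (α * u ^ 2 + μ * v ^ 2) + (μ * (u * v) + u ^ 2 / 2)

lemma modeLyapunov_nonneg {μ α : ℝ} (hμ : 0 ≤ μ) (hα : 0 ≤ α) (u v : ℝ) :
    0 ≤ modeLyapunov μ α u v := by
  have h : modeLyapunov μ α u v =
      (1 + μ) / 2 * (α * u ^ 2) + μ / 2 * v ^ 2 + (μ * v + u) ^ 2 / 2 := by
    unfold modeLyapunov; ring
  rw [h]
  positivity

lemma modeLyapunov_le {μ a₀ α : ℝ} (hμ : 0 ≤ μ) (ha₀ : 0 < a₀) (hα : a₀ ≤ α) (u v : ℝ) :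
    modeLyapunov μ α u v ≤ ((1 + μ) ^ 2 + 1 / a₀) * (α * u ^ 2 + v ^ 2) := by
  have hu : u ^ 2 ≤ 1 / a₀ * (α * u ^ 2) := by
    rw [one_div, inv_mul_eq_div, le_div_iff₀ ha₀, mul_comm]
    exact mul_le_mul_of_nonneg_right hα (sq_nonneg u)
  have hα0 : 0 ≤ α * u ^ 2 := mul_nonneg (ha₀.le.trans hα) (sq_nonneg u)
  have h₁ : 0 ≤ 1 / a₀ * v ^ 2 := by positivity
  have h₂ : 0 ≤ (1 / 2 + 3 * μ / 2 + μ ^ 2) * (α * u ^ 2) :=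
    mul_nonneg (by positivity) hα0
  have h₃ : 0 ≤ (1 + 3 * μ / 2) * v ^ 2 := by positivity
  unfold modeLyapunov
  linear_combination hu + h₁ + h₂ + h₃ + (1 / 2) * sq_nonneg (u - μ * v)

lemma IsModeSolution.hasDerivWithinAt_modeLyapunov {μ α : ℝ} {u u' u'' : ℝ → ℝ}
    (h : IsModeSolution μ α u u' u'') {t : ℝ} (ht : t ∈ Ici (0:ℝ)) :
    HasDerivWithinAt (fun s => modeLyapunov μ α (u s) (u' s))
      (-(α * u t ^ 2 + u' t ^ 2)) (Ici 0) t := by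
  obtain ⟨hu, hv, -, hode⟩ := h
  have hu := hu t ht
  have hv := hv t ht
  have hode := hode t ht
  refine (((((hu.fun_pow 2).const_mul α).fun_add ((hv.fun_pow 2).const_mul μ)).const_mul
    ((1 + μ) / 2)).fun_add
      (((hu.fun_mul hv).const_mul μ).fun_add ((hu.fun_pow 2).div_const 2))).congr_deriv ?_
  norm_num
  linear_combination ((1 + μ) * u' t + u t) * hode

/-- Uniform (in `α ≥ a₀`) square-integrability of the mode energy. -/
theorem mode_energy_integrable (μ a₀ : ℝ) (hμ : 0 < μ) (ha₀ : 0 < a₀) :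
    ∃ c > (0:ℝ), ∀ α : ℝ, a₀ ≤ α →
      ∀ u u' u'' : ℝ → ℝ, IsModeSolution μ α u u' u'' →
        (∫⁻ t in Set.Ioi (0:ℝ), ENNReal.ofReal (α * (u t) ^ 2 + (u' t) ^ 2)) ≤
          ENNReal.ofReal (c * (α * (u 0) ^ 2 + (u' 0) ^ 2)) := by
  refine ⟨(1 + μ) ^ 2 + 1 / a₀, by positivity, fun α hα u u' u'' h => ?_⟩
  have hα0 : 0 ≤ α := ha₀.le.trans hα
  exact (lintegral_dissipation_le (fun t ht => h.hasDerivWithinAt_modeLyapunov ht)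
    (fun t _ => by positivity) (fun t => modeLyapunov_nonneg hμ.le hα0 _ _)).trans
    (ENNReal.ofReal_le_ofReal (modeLyapunov_le hμ.le ha₀ hα _ _))
end

section
/- For every μ > 0, every α > 0, and every y ∈ ℝ, the mode solution u with initial data u(0) = 0 and u'(0) = y satisfies |u(t)| ≤ 2·μ·|y| for all t ≥ 0. -/
open MeasureTheory Set

/-- A function on `[0,∞)` with nonpositive derivative is bounded above by its initial value. -/
lemma le_initial_of_hasDerivWithinAt_nonpos {f f' : ℝ → ℝ}
    (hf : ∀ t ∈ Ici (0:ℝ), HasDerivWithinAt f (f' t) (Ici 0) t)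
    (hf' : ∀ t ∈ Ici (0:ℝ), f' t ≤ 0) {t : ℝ} (ht : 0 ≤ t) : f t ≤ f 0 := by
  have hanti : AntitoneOn f (Ici 0) :=
    antitoneOn_of_hasDerivWithinAt_nonpos (convex_Ici 0)
      (fun s hs => (hf s hs).continuousWithinAt)
      (fun s hs => (hf s (interior_subset hs)).mono interior_subset)
      (fun s hs => hf' s (interior_subset hs))
  exact hanti self_mem_Ici ht ht

/-- The energy `μ·u'² + α·u²` of a mode solution does not exceed its initial value. -/
lemma IsModeSolution.energy_le {μ α : ℝ} {u u' u'' : ℝ → ℝ} (hu : IsModeSolution μ α u u' u'')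
    {t : ℝ} (ht : 0 ≤ t) :
    μ * u' t ^ 2 + α * u t ^ 2 ≤ μ * u' 0 ^ 2 + α * u 0 ^ 2 := by
  obtain ⟨h₁, h₂, -, heq⟩ := hu
  refine le_initial_of_hasDerivWithinAt_nonpos (f := fun t => μ * u' t ^ 2 + α * u t ^ 2)
    (fun s hs => (((h₂ s hs).pow 2).const_mul μ).add (((h₁ s hs).pow 2).const_mul α))
    (fun s hs => ?_) ht
  norm_num
  linear_combination 2 * u' s * heq s hs + 2 * sq_nonneg (u' s)

/-- The modified energy `(μ·u' + u)² + μ·α·u²` of a mode solution does not exceed its initial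
value. -/
lemma IsModeSolution.modified_energy_le {μ α : ℝ} (hα : 0 ≤ α) {u u' u'' : ℝ → ℝ}
    (hu : IsModeSolution μ α u u' u'') {t : ℝ} (ht : 0 ≤ t) :
    (μ * u' t + u t) ^ 2 + μ * α * u t ^ 2 ≤ (μ * u' 0 + u 0) ^ 2 + μ * α * u 0 ^ 2 := by
  obtain ⟨h₁, h₂, -, heq⟩ := hu
  refine le_initial_of_hasDerivWithinAt_nonpos
    (f := fun t => (μ * u' t + u t) ^ 2 + μ * α * u t ^ 2)
    (fun s hs => ((((h₂ s hs).const_mul μ).add (h₁ s hs)).pow 2).add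
      (((h₁ s hs).pow 2).const_mul (μ * α)))
    (fun s hs => ?_) ht
  norm_num
  linear_combination 2 * (μ * u' s + u s) * heq s hs + 2 * mul_nonneg hα (sq_nonneg (u s))

/-- The mode solution with zero initial displacement satisfies `|u(t)| ≤ 2μ|y|`. -/
theorem mode_zero_displacement_bound (μ α : ℝ) (hμ : 0 < μ) (hα : 0 < α) (y : ℝ)
    (u u' u'' : ℝ → ℝ) (hu : IsModeSolution μ α u u' u'')
    (hx : u 0 = 0) (hy : u' 0 = y) :
    ∀ t ≥ (0:ℝ), |u t| ≤ 2 * μ * |y| := by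
  intro t ht
  have henergy := hu.energy_le ht
  have hmodified := hu.modified_energy_le hα.le ht
  rw [hx, hy] at henergy hmodified
  have hvelocity : |μ * u' t| ≤ |μ * y| := by
    apply sq_le_sq.mp
    linear_combination μ * henergy + mul_nonneg (mul_pos hμ hα).le (sq_nonneg (u t))
  have hsum : |μ * u' t + u t| ≤ |μ * y| := by
    apply sq_le_sq.mp
    linear_combination hmodified + mul_nonneg (mul_pos hμ hα).le (sq_nonneg (u t))
  calc |u t| = |(μ * u' t + u t) - μ * u' t| := by rw [add_sub_cancel_left]
    _ ≤ |μ * u' t + u t| + |μ * u' t| := abs_sub _ _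
    _ ≤ |μ * y| + |μ * y| := add_le_add hsum hvelocity
    _ = 2 * μ * |y| := by rw [abs_mul, abs_of_pos hμ]; ring
end

section
/- For every ρ ∈ (0,1) there exists a constant c_ρ > 0 such that for all μ > 0 and all α > 0, the mode solution u with initial data u(0) = 0 and u'(0) = 1/μ satisfies ∫₀^∞ s^{−ρ}·u(s)² ds ≤ c_ρ·α^{ρ−1}. The constant c_ρ depends only on ρ (not on μ or α). -/
open MeasureTheory Set

/-- If `μf' + f ≤ 1` and `f(0) ≤ 1` then `f ≤ 1`. -/
theorem le_one_of_mul_deriv_add_le_one {μ : ℝ} {f f' : ℝ → ℝ} (hμ : 0 < μ)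
    (hc : ContinuousOn f (Ici 0)) (hd : ∀ t, 0 < t → HasDerivAt f (f' t) t)
    (hf : ∀ t, 0 < t → μ * f' t + f t ≤ 1) (h0 : f 0 ≤ 1) {t : ℝ} (ht : 0 ≤ t) : f t ≤ 1 := by
  have hanti : AntitoneOn (fun t => Real.exp (t / μ) * (f t - 1)) (Ici 0) := by
    refine antitoneOn_of_hasDerivWithinAt_nonpos
      (f' := fun t => Real.exp (t / μ) * ((μ * f' t + f t - 1) / μ))
      (convex_Ici 0) (by fun_prop) (fun t ht => ?_) (fun t ht => ?_)
    · rw [interior_Ici] at ht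
      refine HasDerivAt.hasDerivWithinAt
        ((((hasDerivAt_id t).div_const μ).exp.mul ((hd t ht).sub_const 1)).congr_deriv ?_)
      simp only [id_eq]
      field_simp
      ring
    · rw [interior_Ici] at ht
      exact mul_nonpos_of_nonneg_of_nonpos (Real.exp_pos _).le
        (div_nonpos_of_nonpos_of_nonneg (by linarith [hf t ht]) hμ.le)
  have hle := hanti self_mem_Ici ht ht
  simp only [zero_div, Real.exp_zero, one_mul] at hle
  have := Real.exp_pos (t / μ)
  by_contra! hlt
  nlinarith [mul_pos this (sub_pos.2 hlt)]

namespace IsModeSolution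

variable {μ α : ℝ} {u u' u'' : ℝ → ℝ}

theorem hasDerivAt (h : IsModeSolution μ α u u' u'') {t : ℝ} (ht : 0 < t) :
    HasDerivAt u (u' t) t :=
  (h.1 t ht.le).hasDerivAt (Ici_mem_nhds ht)

theorem hasDerivAt_deriv (h : IsModeSolution μ α u u' u'') {t : ℝ} (ht : 0 < t) :
    HasDerivAt u' (u'' t) t :=
  (h.2.1 t ht.le).hasDerivAt (Ici_mem_nhds ht)

theorem continuousOn (h : IsModeSolution μ α u u' u'') : ContinuousOn u (Ici 0) :=
  fun t ht => (h.1 t ht).continuousWithinAt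

theorem continuousOn_deriv (h : IsModeSolution μ α u u' u'') : ContinuousOn u' (Ici 0) :=
  fun t ht => (h.2.1 t ht).continuousWithinAt

/-- The energy `(μu' + u)² + μαu²` dissipates at rate `2αu²`. -/
theorem hasDerivAt_energy (h : IsModeSolution μ α u u' u'') {t : ℝ} (ht : 0 < t) :
    HasDerivAt (fun t => (μ * u' t + u t) ^ 2 + μ * α * u t ^ 2) (-(2 * α * u t ^ 2)) t := by
  have hu := h.hasDerivAt ht
  have hv := ((h.hasDerivAt_deriv ht).const_mul μ).add hu
  refine ((hv.fun_pow 2).add ((hu.fun_pow 2).const_mul (μ * α))).congr_deriv ?_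
  have hode : μ * u'' t + u' t = -(α * u t) := by linarith [h.2.2.2 t ht.le]
  simp only [Pi.add_apply, hode]
  push_cast
  ring

theorem continuousOn_energy (h : IsModeSolution μ α u u' u'') :
    ContinuousOn (fun t => (μ * u' t + u t) ^ 2 + μ * α * u t ^ 2) (Ici 0) := by
  have := h.continuousOn
  have := h.continuousOn_deriv
  fun_prop

theorem antitoneOn_energy (h : IsModeSolution μ α u u' u'') (hα : 0 < α) :
    AntitoneOn (fun t => (μ * u' t + u t) ^ 2 + μ * α * u t ^ 2) (Ici 0) := by
  refine antitoneOn_of_hasDerivWithinAt_nonpos (f' := fun t => -(2 * α * u t ^ 2))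
    (convex_Ici 0) h.continuousOn_energy
    (fun t ht => ?_) (fun t _ => ?_)
  · rw [interior_Ici] at ht
    exact (h.hasDerivAt_energy ht).hasDerivWithinAt
  · have : 0 ≤ 2 * α * u t ^ 2 := by positivity
    linarith

/-- The momentum `μu' + u` of the impulse response stays in `[-1, 1]`. -/
theorem abs_momentum_le_one (h : IsModeSolution μ α u u' u'') (hμ : 0 < μ) (hα : 0 < α)
    (h0 : u 0 = 0) (h1 : u' 0 = 1 / μ) {t : ℝ} (ht : 0 ≤ t) : |μ * u' t + u t| ≤ 1 := by
  have hE := h.antitoneOn_energy hα self_mem_Ici ht ht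
  simp only [h0, h1, mul_one_div_cancel hμ.ne'] at hE
  have : 0 ≤ μ * α * u t ^ 2 := by positivity
  exact abs_le_one_iff_mul_self_le_one.2 (by nlinarith)

theorem abs_le_one (h : IsModeSolution μ α u u' u'') (hμ : 0 < μ) (hα : 0 < α)
    (h0 : u 0 = 0) (h1 : u' 0 = 1 / μ) {t : ℝ} (ht : 0 ≤ t) : |u t| ≤ 1 := by
  have hv := fun s (hs : 0 < s) => abs_le.1 (h.abs_momentum_le_one hμ hα h0 h1 hs.le)
  refine abs_le'.2 ⟨?_, ?_⟩
  · exact le_one_of_mul_deriv_add_le_one hμ h.continuousOn (fun s hs => h.hasDerivAt hs)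
      (fun s hs => (hv s hs).2) (by simp [h0]) ht
  · exact le_one_of_mul_deriv_add_le_one (f := fun s => -u s) (f' := fun s => -u' s) hμ
      h.continuousOn.neg (fun s hs => (h.hasDerivAt hs).neg)
      (fun s hs => by linarith [(hv s hs).1]) (by simp [h0]) ht

/-- Integrated energy dissipation: `2α ∫₀^∞ u² ≤ 1` for the impulse response. -/
theorem lintegral_sq_le (h : IsModeSolution μ α u u' u'') (hμ : 0 < μ) (hα : 0 < α)
    (h0 : u 0 = 0) (h1 : u' 0 = 1 / μ) :
    ∫⁻ s in Ioi (0 : ℝ), ENNReal.ofReal (2 * α * u s ^ 2) ≤ 1 := by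
  set E : ℝ → ℝ := fun t => (μ * u' t + u t) ^ 2 + μ * α * u t ^ 2 with hE
  have hE_nonneg : ∀ t, 0 ≤ E t := fun t => by simp only [hE]; positivity
  have hanti : Antitone fun t => E (max t 0) := fun s t hst =>
    h.antitoneOn_energy hα (le_max_right s 0) (le_max_right t 0) (max_le_max_right 0 hst)
  have hlim : Filter.Tendsto E Filter.atTop (nhds (⨅ t, E (max t 0))) :=
    (tendsto_atTop_ciInf hanti ⟨0, by rintro _ ⟨t, rfl⟩; exact hE_nonneg _⟩).congr'
      ((Filter.eventually_ge_atTop 0).mono fun t ht => by simp [ht])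
  have hcont : ContinuousWithinAt E (Ici 0) 0 := h.continuousOn_energy 0 self_mem_Ici
  have hderiv : ∀ t ∈ Ioi (0 : ℝ), HasDerivAt E (-(2 * α * u t ^ 2)) t :=
    fun t ht => h.hasDerivAt_energy ht
  have hneg : ∀ t ∈ Ioi (0 : ℝ), -(2 * α * u t ^ 2) ≤ 0 := fun t _ => by
    have : 0 ≤ 2 * α * u t ^ 2 := by positivity
    linarith
  have hint : IntegrableOn (fun t => 2 * α * u t ^ 2) (Ioi 0) := by
    simpa using (integrableOn_Ioi_deriv_of_nonpos hcont hderiv hneg hlim).neg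
  have hval := integral_Ioi_of_hasDerivAt_of_nonpos hcont hderiv hneg hlim
  rw [integral_neg] at hval
  rw [← ofReal_integral_eq_lintegral_ofReal hint
    (Filter.Eventually.of_forall fun t => by simp only [Pi.zero_apply]; positivity)]
  have hE0 : E 0 = 1 := by simp [hE, h0, h1, hμ.ne']
  have hinf : 0 ≤ ⨅ t, E (max t 0) := Real.iInf_nonneg fun t => hE_nonneg _
  exact ENNReal.ofReal_le_one.2 (by linarith)

end IsModeSolution

theorem lintegral_Ioc_rpow_neg {ρ : ℝ} (hρ : ρ < 1) {a : ℝ} (ha : 0 ≤ a) :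
    ∫⁻ s in Ioc 0 a, ENNReal.ofReal (s ^ (-ρ)) = ENNReal.ofReal (a ^ (1 - ρ) / (1 - ρ)) := by
  have hint : IntervalIntegrable (fun s : ℝ => s ^ (-ρ)) volume 0 a :=
    intervalIntegral.intervalIntegrable_rpow' (by linarith)
  rw [← ofReal_integral_eq_lintegral_ofReal
      ((intervalIntegrable_iff_integrableOn_Ioc_of_le ha).1 hint)
      ((ae_restrict_mem measurableSet_Ioc).mono fun s hs => Real.rpow_nonneg hs.1.le _),
    ← intervalIntegral.integral_of_le ha, integral_rpow (Or.inl (by linarith)),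
    neg_add_eq_sub, Real.zero_rpow (by linarith), sub_zero]

/-- Uniform-in-`μ` weighted square-integrability of the impulse response mode:
`∫₀^∞ s^{-ρ} u(s)² ds ≤ c_ρ α^{ρ-1}`, with `c_ρ` depending only on `ρ ∈ (0,1)`. -/
theorem mode_impulse_response_weighted_bound (ρ : ℝ) (hρ : ρ ∈ Set.Ioo (0:ℝ) 1) :
    ∃ c > (0:ℝ), ∀ μ α : ℝ, 0 < μ → 0 < α →
      ∀ u u' u'' : ℝ → ℝ, IsModeSolution μ α u u' u'' →
        u 0 = 0 → u' 0 = 1 / μ →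
        (∫⁻ s in Set.Ioi (0:ℝ), ENNReal.ofReal (s ^ (-ρ) * (u s) ^ 2)) ≤
          ENNReal.ofReal (c * α ^ (ρ - 1)) := by
  obtain ⟨hρ0, hρ1⟩ := hρ
  have hρ' : 0 < 1 - ρ := sub_pos.2 hρ1
  refine ⟨1 / (1 - ρ) + 1 / 2, by positivity, fun μ α hμ hα u u' u'' h h0 h1 => ?_⟩
  -- Use `|u| ≤ 1` on `(0, 1/α]` and `s^{-ρ} ≤ α^ρ` on `(1/α, ∞)`.
  have hpt : ∀ s ∈ Ioi (0 : ℝ), ENNReal.ofReal (s ^ (-ρ) * u s ^ 2) ≤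
      (Ioc 0 α⁻¹).indicator (fun s => ENNReal.ofReal (s ^ (-ρ))) s +
        ENNReal.ofReal (α ^ (ρ - 1) / 2) * ENNReal.ofReal (2 * α * u s ^ 2) := by
    intro s hs
    have hs' : 0 < s := hs
    by_cases hsα : s ≤ α⁻¹
    · rw [indicator_of_mem (show s ∈ Ioc 0 α⁻¹ from ⟨hs', hsα⟩)]
      refine le_add_right (ENNReal.ofReal_le_ofReal ?_)
      exact mul_le_of_le_one_right (Real.rpow_nonneg hs'.le _)
        ((sq_le_one_iff_abs_le_one _).2 (h.abs_le_one hμ hα h0 h1 hs'.le))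
    · rw [← ENNReal.ofReal_mul (by positivity)]
      refine le_add_left (ENNReal.ofReal_le_ofReal ?_)
      have hpow : s ^ (-ρ) ≤ α ^ ρ := by
        have := Real.rpow_le_rpow_of_nonpos (inv_pos.2 hα) (not_le.1 hsα).le
          (neg_nonpos.2 hρ0.le)
        rwa [Real.inv_rpow hα.le, Real.rpow_neg hα.le, inv_inv] at this
      calc s ^ (-ρ) * u s ^ 2 ≤ α ^ ρ * u s ^ 2 := by gcongr
        _ = α ^ (ρ - 1) / 2 * (2 * α * u s ^ 2) := by
          rw [Real.rpow_sub_one hα.ne']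
          field_simp
  calc ∫⁻ s in Ioi (0 : ℝ), ENNReal.ofReal (s ^ (-ρ) * u s ^ 2)
      ≤ ∫⁻ s in Ioi (0 : ℝ), ((Ioc 0 α⁻¹).indicator (fun s => ENNReal.ofReal (s ^ (-ρ))) s +
          ENNReal.ofReal (α ^ (ρ - 1) / 2) * ENNReal.ofReal (2 * α * u s ^ 2)) :=
        setLIntegral_mono' measurableSet_Ioi hpt
    _ = (∫⁻ s in Ioc 0 α⁻¹, ENNReal.ofReal (s ^ (-ρ))) + ENNReal.ofReal (α ^ (ρ - 1) / 2) *
          ∫⁻ s in Ioi (0 : ℝ), ENNReal.ofReal (2 * α * u s ^ 2) := by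
        rw [lintegral_add_left ((by fun_prop : Measurable fun s : ℝ =>
            ENNReal.ofReal (s ^ (-ρ))).indicator measurableSet_Ioc),
          setLIntegral_indicator measurableSet_Ioc,
          inter_eq_left.2 Ioc_subset_Ioi_self, lintegral_const_mul' _ _ ENNReal.ofReal_ne_top]
    _ ≤ ENNReal.ofReal (α⁻¹ ^ (1 - ρ) / (1 - ρ)) + ENNReal.ofReal (α ^ (ρ - 1) / 2) * 1 := by
        rw [lintegral_Ioc_rpow_neg hρ1 (inv_pos.2 hα).le]
        gcongr
        exact h.lintegral_sq_le hμ hα h0 h1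
    _ = ENNReal.ofReal ((1 / (1 - ρ) + 1 / 2) * α ^ (ρ - 1)) := by
        rw [mul_one, ← ENNReal.ofReal_add (by positivity) (by positivity),
          Real.inv_rpow hα.le, ← Real.rpow_neg hα.le, neg_sub]
        ring_nf
end

section
/- For every α > 0 and every T > 0 there exists a constant c = c(α,T) > 0 such that for every μ ∈ (0,1] and every x ∈ ℝ, the mode solution u with initial data u(0) = x and u'(0) = 0 satisfies sup_{t ∈ [0,T]} |u(t) − e^{−αt}·x| ≤ c·μ·|x|. -/
open MeasureTheory Set

/-- A function on `[0,∞)` that starts nonnegative and satisfies `z' + k·z ≥ 0`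
stays nonnegative. -/
lemma nonneg_of_deriv_add_mul_nonneg {k : ℝ} {z z' : ℝ → ℝ}
    (hz : ∀ t ∈ Ici (0:ℝ), HasDerivWithinAt z (z' t) (Ici 0) t)
    (h : ∀ t ∈ Ici (0:ℝ), 0 ≤ z' t + k * z t) (h0 : 0 ≤ z 0) {t : ℝ} (ht : 0 ≤ t) :
    0 ≤ z t := by
  have hd : ∀ s ∈ Ici (0:ℝ), HasDerivWithinAt (fun s => Real.exp (k * s) * z s)
      (Real.exp (k * s) * (z' s + k * z s)) (Ici 0) s := fun s hs => by
    have he : HasDerivAt (fun s => Real.exp (k * s)) (Real.exp (k * s) * (k * 1)) s :=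
      ((hasDerivAt_id s).const_mul k).exp
    exact (he.hasDerivWithinAt.mul (hz s hs)).congr_deriv (by ring)
  have hmono : MonotoneOn (fun s => Real.exp (k * s) * z s) (Ici 0) :=
    monotoneOn_of_hasDerivWithinAt_nonneg (convex_Ici 0)
      (fun s hs => (hd s hs).continuousWithinAt)
      (fun s hs => (hd s (interior_subset hs)).mono interior_subset)
      (fun s hs => mul_nonneg (Real.exp_pos _).le (h s (interior_subset hs)))
  have hle := hmono self_mem_Ici (mem_Ici.2 ht) ht
  simp only [mul_zero, Real.exp_zero, one_mul] at hle
  exact nonneg_of_mul_nonneg_right (h0.trans hle) (Real.exp_pos _)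

/-- The relaxation equation `y' = k·(f - y)` preserves any bound `M` on the forcing. -/
lemma abs_le_of_deriv_eq_mul_sub {k M : ℝ} (hk : 0 ≤ k) {y f : ℝ → ℝ}
    (hy : ∀ t ∈ Ici (0:ℝ), HasDerivWithinAt y (k * (f t - y t)) (Ici 0) t)
    (hf : ∀ t ∈ Ici (0:ℝ), |f t| ≤ M) (h0 : |y 0| ≤ M) {t : ℝ} (ht : 0 ≤ t) :
    |y t| ≤ M := by
  rw [abs_le] at h0 ⊢
  have hlower := nonneg_of_deriv_add_mul_nonneg (k := k) (z := fun s => M + y s)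
    (fun s hs => (hy s hs).const_add M)
    (fun s hs => by
      nlinarith [mul_nonneg hk (neg_le_iff_add_nonneg.1 (abs_le.1 (hf s hs)).1)])
    (by linarith [h0.1]) ht
  have hupper := nonneg_of_deriv_add_mul_nonneg (k := k) (z := fun s => M - y s)
    (fun s hs => (hy s hs).const_sub M)
    (fun s hs => by
      nlinarith [mul_nonneg hk (sub_nonneg.2 (abs_le.1 (hf s hs)).2)])
    (by linarith [h0.2]) ht
  constructor <;> linarith

namespace IsModeSolution

variable {μ α : ℝ} {u u' u'' : ℝ → ℝ}

/-- Dissipation of the energy `μ·u'² + α·u²` bounds a mode solution starting at rest. -/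
lemma abs_le (h : IsModeSolution μ α u u' u'') (hμ : 0 ≤ μ) (hα : 0 < α) (h0 : u' 0 = 0)
    {t : ℝ} (ht : 0 ≤ t) : |u t| ≤ |u 0| := by
  obtain ⟨hu, hu', -, hode⟩ := h
  have henergy := nonneg_of_deriv_add_mul_nonneg (k := 0)
    (z := fun s => α * u 0 ^ 2 - (μ * u' s ^ 2 + α * u s ^ 2)) (z' := fun s => 2 * u' s ^ 2)
    (fun s hs => by
      refine (((((hu' s hs).pow 2).const_mul μ).add
        (((hu s hs).pow 2).const_mul α)).const_sub (α * u 0 ^ 2)).congr_deriv ?_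
      norm_num
      linear_combination (-2 * u' s) * hode s hs)
    (fun s _ => by rw [zero_mul, add_zero]; positivity) (by simp [h0]) ht
  refine sq_le_sq.1 (le_of_mul_le_mul_left ?_ hα)
  nlinarith [mul_nonneg hμ (sq_nonneg (u' t))]

lemma abs_deriv_le (h : IsModeSolution μ α u u' u'') (hμ : 0 < μ) (hα : 0 < α)
    (h0 : u' 0 = 0) {t : ℝ} (ht : 0 ≤ t) : |u' t| ≤ α * |u 0| := by
  refine abs_le_of_deriv_eq_mul_sub (k := μ⁻¹) (f := fun s => -(α * u s))
    (inv_nonneg.2 hμ.le) (fun s hs => (h.2.1 s hs).congr_deriv ?_) (fun s hs => ?_) ?_ ht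
  · rw [eq_inv_mul_iff_mul_eq₀ hμ.ne']
    linear_combination h.2.2.2 s hs
  · rw [abs_neg, abs_mul, abs_of_pos hα]
    exact mul_le_mul_of_nonneg_left (h.abs_le hμ.le hα h0 hs) hα.le
  · rw [h0, abs_zero]
    positivity

/-- The corrected mode `u + μ·u'` solves the heat-mode equation up to the forcing `α·μ·u'`. -/
lemma abs_add_mul_deriv_sub_exp_le (h : IsModeSolution μ α u u' u'') (hμ : 0 < μ) (hα : 0 < α)
    (h0 : u' 0 = 0) {t : ℝ} (ht : 0 ≤ t) :
    |u t + μ * u' t - Real.exp (-α * t) * u 0| ≤ μ * (α * |u 0|) := by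
  refine abs_le_of_deriv_eq_mul_sub (k := α) (f := fun s => μ * u' s)
    (y := fun s => u s + μ * u' s - Real.exp (-α * s) * u 0)
    hα.le (fun s hs => ?_) (fun s hs => ?_) ?_ ht
  · have he : HasDerivAt (fun s => Real.exp (-α * s)) (Real.exp (-α * s) * (-α * 1)) s :=
      ((hasDerivAt_id s).const_mul (-α)).exp
    refine (((h.1 s hs).add ((h.2.1 s hs).const_mul μ)).sub
      (he.hasDerivWithinAt.mul_const (u 0))).congr_deriv ?_
    linear_combination h.2.2.2 s hs
  · rw [abs_mul, abs_of_pos hμ]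
    exact mul_le_mul_of_nonneg_left (h.abs_deriv_le hμ hα h0 hs) hμ.le
  · simp only [h0, mul_zero, add_zero, Real.exp_zero, one_mul, sub_self, abs_zero]
    positivity

end IsModeSolution

/-- Per-mode Smoluchowski–Kramers approximation rate: the mode solution with data
`(x,0)` is `O(μ)`-close to the heat-mode `e^{-αt}x`, uniformly on `[0,T]`. -/
theorem mode_convergence_rate (α T : ℝ) (hα : 0 < α) (hT : 0 < T) :
    ∃ c > (0:ℝ), ∀ μ : ℝ, 0 < μ → μ ≤ 1 →
      ∀ x : ℝ, ∀ u u' u'' : ℝ → ℝ, IsModeSolution μ α u u' u'' →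
        u 0 = x → u' 0 = 0 →
        ∀ t ∈ Set.Icc (0:ℝ) T, |u t - Real.exp (-α * t) * x| ≤ c * μ * |x| := by
  refine ⟨2 * α, by positivity, ?_⟩
  rintro μ hμ - x u u' u'' h rfl h0 t ht
  have hw := h.abs_add_mul_deriv_sub_exp_le hμ hα h0 ht.1
  have hd : |μ * u' t| ≤ μ * (α * |u 0|) := by
    rw [abs_mul, abs_of_pos hμ]
    exact mul_le_mul_of_nonneg_left (h.abs_deriv_le hμ hα h0 ht.1) hμ.le
  calc |u t - Real.exp (-α * t) * u 0|
      = |(u t + μ * u' t - Real.exp (-α * t) * u 0) - μ * u' t| := by ring_nf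
    _ ≤ μ * (α * |u 0|) + μ * (α * |u 0|) := (abs_sub _ _).trans (add_le_add hw hd)
    _ = 2 * α * μ * |u 0| := by ring
end

section
/- Let λ ∈ (1,3] and let b : ℝ → ℝ be continuous and satisfy |b(σ)| ≤ c₀(1 + |σ|^λ) for all σ (some c₀ > 0) and b(σ)·σ ≤ −c₁|σ|^{λ+1} + c₂ for all σ (some c₁ > 0, c₂ ∈ ℝ). Then there exist κ₁ > 0 and κ₂ ≥ 0 such that for all σ, ρ ∈ ℝ: b(σ + ρ)·σ ≤ −κ₁|σ|^{λ+1} + κ₂(1 + |ρ|^{λ+1}). -/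
/-- Young's inequality with a small parameter, with non-optimal constants. -/
theorem Real.rpow_mul_le_mul_rpow_add {l ε x y : ℝ} (hl : 0 ≤ l) (hε : 0 < ε) (hx : 0 ≤ x)
    (hy : 0 ≤ y) : x ^ l * y ≤ ε * x ^ (l + 1) + (ε ^ l)⁻¹ * y ^ (l + 1) := by
  have hl' : l + 1 ≠ 0 := by positivity
  rw [Real.rpow_add_one' hx hl', Real.rpow_add_one' hy hl']
  rcases le_total y (ε * x) with h | h
  · have h₁ : x ^ l * y ≤ x ^ l * (ε * x) := by gcongr
    have h₂ : 0 ≤ (ε ^ l)⁻¹ * (y ^ l * y) := by positivity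
    linarith
  · have h₁ : x ^ l ≤ (ε ^ l)⁻¹ * y ^ l := by
      rw [le_inv_mul_iff₀ (by positivity), ← Real.mul_rpow hε.le hx]
      gcongr
    have h₂ : x ^ l * y ≤ (ε ^ l)⁻¹ * y ^ l * y := by gcongr
    have h₃ : 0 ≤ ε * (x ^ l * x) := by positivity
    linarith

theorem Real.abs_add_rpow_le {p : ℝ} (hp : 0 ≤ p) (x y : ℝ) :
    |x + y| ^ p ≤ 2 ^ p * (|x| ^ p + |y| ^ p) := by
  have h : |x + y| ≤ 2 * max |x| |y| := by
    linarith [abs_add_le x y, le_max_left |x| |y|, le_max_right |x| |y|]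
  calc |x + y| ^ p ≤ (2 * max |x| |y|) ^ p := by gcongr
    _ = 2 ^ p * max |x| |y| ^ p := Real.mul_rpow (by norm_num) (by positivity)
    _ ≤ 2 ^ p * (|x| ^ p + |y| ^ p) := by
      gcongr
      have hx : 0 ≤ |x| ^ p := by positivity
      have hy : 0 ≤ |y| ^ p := by positivity
      rcases max_choice |x| |y| with h | h <;> rw [h] <;> linarith

theorem Real.le_one_add_rpow {p x : ℝ} (hp : 1 ≤ p) (hx : 0 ≤ x) : x ≤ 1 + x ^ p := by
  rcases le_total x 1 with h | h
  · linarith [Real.rpow_nonneg hx p]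
  · linarith [Real.self_le_rpow_of_one_le h hp]

/-- Shifted dissipativity estimate for a polynomial nonlinearity: if
`|b(σ)| ≤ c₀(1+|σ|^λ)` and `b(σ)σ ≤ -c₁|σ|^{λ+1} + c₂` with `λ ∈ (1,3]`, then
`b(σ+ρ)σ ≤ -κ₁|σ|^{λ+1} + κ₂(1+|ρ|^{λ+1})` for some `κ₁ > 0`, `κ₂ ≥ 0`. -/
theorem shifted_dissipativity (l : ℝ) (hl1 : 1 < l) (hl3 : l ≤ 3)
    (b : ℝ → ℝ) (hb : Continuous b)
    (c₀ : ℝ) (hc₀ : 0 < c₀) (hgrowth : ∀ σ : ℝ, |b σ| ≤ c₀ * (1 + |σ| ^ l))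
    (c₁ c₂ : ℝ) (hc₁ : 0 < c₁)
    (hdiss : ∀ σ : ℝ, b σ * σ ≤ -c₁ * |σ| ^ (l + 1) + c₂) :
    ∃ κ₁ > (0:ℝ), ∃ κ₂ ≥ (0:ℝ), ∀ σ ρ : ℝ,
      b (σ + ρ) * σ ≤ -κ₁ * |σ| ^ (l + 1) + κ₂ * (1 + |ρ| ^ (l + 1)) := by
  have hε : 0 < c₁ / (2 * c₀) := by positivity
  refine ⟨c₁ / 2 * (2 ^ (l + 1))⁻¹, by positivity,
    c₁ / 2 + |c₂| + c₀ + c₀ * ((c₁ / (2 * c₀)) ^ l)⁻¹, by positivity, fun σ ρ => ?_⟩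
  have hcross : -(b (σ + ρ) * ρ) ≤ c₀ * (1 + |σ + ρ| ^ l) * |ρ| :=
    calc -(b (σ + ρ) * ρ) ≤ |b (σ + ρ)| * |ρ| := by
          rw [← abs_mul]
          exact neg_le_abs _
      _ ≤ c₀ * (1 + |σ + ρ| ^ l) * |ρ| := by
          gcongr
          exact hgrowth _
  have hyoung := mul_le_mul_of_nonneg_left (Real.rpow_mul_le_mul_rpow_add (l := l) (by linarith)
    hε (abs_nonneg (σ + ρ)) (abs_nonneg ρ)) hc₀.le
  have hlin := mul_le_mul_of_nonneg_left
    (Real.le_one_add_rpow (p := l + 1) (by linarith) (abs_nonneg ρ)) hc₀.le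
  have hsplit : (2 ^ (l + 1))⁻¹ * |σ| ^ (l + 1) ≤ |σ + ρ| ^ (l + 1) + |ρ| ^ (l + 1) := by
    rw [inv_mul_le_iff₀ (by positivity)]
    simpa using Real.abs_add_rpow_le (p := l + 1) (by linarith) (σ + ρ) (-ρ)
  have hsplit' := mul_le_mul_of_nonneg_left hsplit (half_pos hc₁).le
  have hc₂R : 0 ≤ |c₂| * |ρ| ^ (l + 1) := by positivity
  have hconst : 0 ≤ c₀ * ((c₁ / (2 * c₀)) ^ l)⁻¹ := by positivity
  have hcε : c₀ * (c₁ / (2 * c₀) * |σ + ρ| ^ (l + 1)) = c₁ / 2 * |σ + ρ| ^ (l + 1) := by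
    field_simp
  linarith [hdiss (σ + ρ), le_abs_self c₂]
end

section
/- Let a > 0, K ≥ 0, q > 1 and T > 0, and let f : [0,T] → [0,∞) be differentiable with f'(t) ≤ −a·f(t)^q + K for all t ∈ [0,T]. Then for every t ∈ (0,T]: f(t) ≤ ((q−1)·a·t)^{−1/(q−1)} + (K/a)^{1/q}. -/
open Set

/-- ODE comparison principle: if `f ≥ 0` on `[0,T]` and `f' ≤ -a f^q + K` with
`a > 0`, `q > 1`, then `f(t) ≤ ((q-1)at)^{-1/(q-1)} + (K/a)^{1/q}` for `t ∈ (0,T]`. -/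
theorem ode_comparison_principle (a K q T : ℝ)
    (ha : 0 < a) (hK : 0 ≤ K) (hq : 1 < q) (hT : 0 < T)
    (f f' : ℝ → ℝ)
    (hnonneg : ∀ t ∈ Set.Icc (0:ℝ) T, 0 ≤ f t)
    (hderiv : ∀ t ∈ Set.Icc (0:ℝ) T, HasDerivWithinAt f (f' t) (Set.Icc 0 T) t)
    (hineq : ∀ t ∈ Set.Icc (0:ℝ) T, f' t ≤ -a * (f t) ^ q + K) :
    ∀ t : ℝ, 0 < t → t ≤ T →
      f t ≤ ((q - 1) * a * t) ^ (-(1 / (q - 1))) + (K / a) ^ (1 / q) := by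
  intro t ht0 htT
  have hq1 : 0 < q - 1 := by linarith
  have hf0 : 0 ≤ f 0 := hnonneg 0 ⟨le_rfl, hT.le⟩
  set p : ℝ := -(1 / (q - 1)) with hp
  have hp_neg : p < 0 := by rw [hp]; exact neg_neg_of_pos (by positivity)
  have hpq : p * q = p - 1 := by rw [hp]; field_simp; ring
  have hpq1 : p * (q - 1) = -1 := by linarith
  set c : ℝ := (K / a) ^ (1 / q) with hc
  have hc0 : 0 ≤ c := by positivity
  have hcq : a * c ^ q = K := by
    rw [hc, ← Real.rpow_mul (by positivity), one_div_mul_cancel (by positivity), Real.rpow_one]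
    field_simp
  set M : ℝ := (f 0 + 1) ^ (-(q - 1)) with hM
  have hM0 : 0 < M := by positivity
  -- Compare `f` with the barrier `u ^ p + c`: on `[0, T]`, `u s` stays above `(q - 1) * a * s`, and
  -- it grows strictly more slowly, so that the barrier is a strict supersolution.
  let u : ℝ → ℝ := fun s => M * (1 - s / T) + (q - 1) * a * s
  have hM_part : ∀ s ∈ Icc (0 : ℝ) T, 0 ≤ M * (1 - s / T) := fun s hs =>
    mul_nonneg hM0.le (sub_nonneg.2 ((div_le_one hT).2 hs.2))
  have hu_pos : ∀ s ∈ Icc (0 : ℝ) T, 0 < u s := by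
    intro s hs
    rcases hs.1.eq_or_lt with rfl | h
    · simpa [u] using hM0
    · exact add_pos_of_nonneg_of_pos (hM_part s hs) (by positivity)
  have hu_deriv : ∀ s, HasDerivAt u ((q - 1) * a - M / T) s := by
    intro s
    have h := ((((hasDerivAt_id s).div_const T).const_sub 1).const_mul M).add
      ((hasDerivAt_id s).const_mul ((q - 1) * a))
    exact h.congr_deriv (by ring)
  have hB_deriv : ∀ s ∈ Icc (0 : ℝ) T, HasDerivAt (fun s => u s ^ p + c)
      (((q - 1) * a - M / T) * p * u s ^ (p - 1)) s := fun s hs =>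
    ((hu_deriv s).rpow_const (Or.inl (hu_pos s hs).ne')).add_const c
  have hB_zero : f 0 ≤ u 0 ^ p + c := by
    have h : u 0 ^ p = f 0 + 1 := by
      simp only [u, zero_div, sub_zero, mul_one, mul_zero, add_zero, hM]
      rw [← Real.rpow_mul (by positivity), show -(q - 1) * p = 1 by linarith, Real.rpow_one]
    linarith
  have hfB : f t ≤ u t ^ p + c := by
    refine image_le_of_deriv_right_lt_deriv_boundary'
      (fun s hs => (hderiv s hs).continuousWithinAt)
      (fun s hs => (hderiv s ⟨hs.1, hs.2.le⟩).mono_of_mem_nhdsWithin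
        (Icc_mem_nhdsGE_of_mem hs)) hB_zero
      (fun s hs => (hB_deriv s hs).continuousAt.continuousWithinAt)
      (fun s hs => (hB_deriv s ⟨hs.1, hs.2.le⟩).hasDerivWithinAt) ?_ ⟨ht0.le, htT⟩
    intro s hs hfs
    have hs' : s ∈ Icc (0 : ℝ) T := ⟨hs.1, hs.2.le⟩
    have hus := hu_pos s hs'
    have h_super : (u s ^ p) ^ q + c ^ q ≤ (u s ^ p + c) ^ q :=
      Real.add_rpow_le_rpow_add (by positivity) hc0 hq.le
    rw [← Real.rpow_mul hus.le, hpq] at h_super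
    have h_f' := hineq s hs'
    rw [hfs] at h_f'
    have h_slope : -a < ((q - 1) * a - M / T) * p := by
      have : M / T * p < 0 := mul_neg_of_pos_of_neg (by positivity) hp_neg
      linear_combination this - a * hpq1
    calc f' s ≤ -a * (u s ^ p + c) ^ q + K := h_f'
      _ ≤ -a * u s ^ (p - 1) := by
        linarith [mul_le_mul_of_nonneg_left h_super ha.le]
      _ < _ := mul_lt_mul_of_pos_right h_slope (by positivity)
  have hut : (q - 1) * a * t ≤ u t := le_add_of_nonneg_left (hM_part t ⟨ht0.le, htT⟩)
  have h_anti : u t ^ p ≤ ((q - 1) * a * t) ^ p :=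
    Real.rpow_le_rpow_of_nonpos (by positivity) hut hp_neg.le
  linarith
end

section
/- Let H be a real inner product space and let μ̄, ϑ̄, κ, c₀, d₀ > 0 be given. Then there exist constants c₁, c₂ > 0 such that for all μ ∈ (0, μ̄], ϑ ∈ (0, ϑ̄], all u, v ∈ H, all a ≥ 0, p ≥ 0 and all m ∈ ℝ with 2κμp ≤ m ≤ 2c₀μ(p + d₀), one has c₁·(μa + μp + ‖u‖² + μ²‖v‖²) ≤ μa + (ϑμ + 1/2)‖u‖² + μ²‖ϑu + v‖² + μ⟨u,v⟩ + m ≤ c₂·(μa + μp + ‖u‖² + μ²‖v‖² + 1). -/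
open RealInnerProductSpace

section QuadraticForm

variable {H : Type*} [NormedAddCommGroup H] [InnerProductSpace ℝ H]

lemma norm_add_sq_le_two_mul (x y : H) : ‖x + y‖ ^ 2 ≤ 2 * ‖x‖ ^ 2 + 2 * ‖y‖ ^ 2 := by
  nlinarith [parallelogram_law_with_norm ℝ x y, sq_nonneg ‖x - y‖]

/-- The quadratic part of the Lyapunov functional, in the shifted variable `w = s • x + y`. -/
lemma quadratic_part_eq (s : ℝ) (x y : H) :
    (s + 1 / 2) * ‖x‖ ^ 2 + ‖s • x + y‖ ^ 2 + ⟪x, y⟫ =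
      1 / 2 * ‖x‖ ^ 2 + ‖s • x + y‖ ^ 2 + ⟪x, s • x + y⟫ := by
  rw [inner_add_right, real_inner_smul_right, real_inner_self_eq_norm_sq]
  ring

lemma le_quadratic_part (s : ℝ) (x y : H) :
    ‖x‖ ^ 2 + ‖y‖ ^ 2 ≤
      16 * (1 + s ^ 2) * ((s + 1 / 2) * ‖x‖ ^ 2 + ‖s • x + y‖ ^ 2 + ⟪x, y⟫) := by
  rw [quadratic_part_eq]
  set w := s • x + y with hw
  have hy : ‖y‖ ^ 2 ≤ 2 * ‖w‖ ^ 2 + 2 * (s ^ 2 * ‖x‖ ^ 2) := by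
    have h := norm_add_sq_le_two_mul w (-(s • x))
    rwa [hw, add_neg_cancel_comm, ← hw, norm_neg, norm_smul, mul_pow, Real.norm_eq_abs,
      sq_abs] at h
  have hcs := neg_le_of_abs_le (abs_real_inner_le_norm x w)
  have hpos : 1 / 8 * (‖x‖ ^ 2 + ‖w‖ ^ 2) ≤ 1 / 2 * ‖x‖ ^ 2 + ‖w‖ ^ 2 + ⟪x, w⟫ := by
    nlinarith [sq_nonneg (3 * ‖x‖ - 4 * ‖w‖), sq_nonneg ‖w‖]
  have hmul := mul_le_mul_of_nonneg_left hpos (by positivity : 0 ≤ 16 * (1 + s ^ 2))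
  have hsw : 0 ≤ s ^ 2 * ‖w‖ ^ 2 := by positivity
  nlinarith [sq_nonneg ‖x‖]

lemma quadratic_part_le (s : ℝ) (x y : H) :
    (s + 1 / 2) * ‖x‖ ^ 2 + ‖s • x + y‖ ^ 2 + ⟪x, y⟫ ≤
      3 * (1 + s ^ 2) * (‖x‖ ^ 2 + ‖y‖ ^ 2) := by
  rw [quadratic_part_eq]
  have hw := norm_add_sq_le_two_mul (s • x) y
  rw [norm_smul, mul_pow, Real.norm_eq_abs, sq_abs] at hw
  have hcs := real_inner_le_norm x (s • x + y)
  have hsy : 0 ≤ s ^ 2 * ‖y‖ ^ 2 := by positivity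
  nlinarith [sq_nonneg (‖x‖ - ‖s • x + y‖), sq_nonneg ‖x‖]

end QuadraticForm

/-- Abstract equivalence `c₁ K_μ ≤ K_{ϑ,μ} ≤ c₂(K_μ + 1)` between the Lyapunov
functional and the energy, uniformly for `μ ∈ (0,μ̄]`, `ϑ ∈ (0,ϑ̄]`. Here `a`
stands for `|u|²_{H¹}`, `p` for `|u|^{λ+1}_{L^{λ+1}}`, and `m` for
`-2μ∫𝔟(u)`, which satisfies `2κμp ≤ m ≤ 2c₀μ(p + d₀)`. -/
theorem lyapunov_energy_equivalence
    {H : Type*} [NormedAddCommGroup H] [InnerProductSpace ℝ H]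
    (μbar ϑbar κ c₀ d₀ : ℝ)
    (hμbar : 0 < μbar) (hϑbar : 0 < ϑbar) (hκ : 0 < κ) (hc₀ : 0 < c₀) (hd₀ : 0 < d₀) :
    ∃ c₁ > (0:ℝ), ∃ c₂ > (0:ℝ),
      ∀ μ ϑ : ℝ, 0 < μ → μ ≤ μbar → 0 < ϑ → ϑ ≤ ϑbar →
        ∀ (u v : H) (a p m : ℝ), 0 ≤ a → 0 ≤ p →
          2 * κ * μ * p ≤ m → m ≤ 2 * c₀ * μ * (p + d₀) →
          c₁ * (μ * a + μ * p + ‖u‖ ^ 2 + μ ^ 2 * ‖v‖ ^ 2) ≤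
              μ * a + (ϑ * μ + 1 / 2) * ‖u‖ ^ 2 + μ ^ 2 * ‖ϑ • u + v‖ ^ 2 +
                μ * ⟪u, v⟫ + m ∧
            μ * a + (ϑ * μ + 1 / 2) * ‖u‖ ^ 2 + μ ^ 2 * ‖ϑ • u + v‖ ^ 2 +
                μ * ⟪u, v⟫ + m ≤
              c₂ * (μ * a + μ * p + ‖u‖ ^ 2 + μ ^ 2 * ‖v‖ ^ 2 + 1) := by
  set S := ϑbar * μbar with hS
  refine ⟨min (min 1 (2 * κ)) (1 / (16 * (1 + S ^ 2))), by positivity,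
    1 + 3 * (1 + S ^ 2) + 2 * c₀ + 2 * c₀ * μbar * d₀, by positivity, ?_⟩
  intro μ ϑ hμ hμle hϑ hϑle u v a p m ha hp hm₁ hm₂
  have hs : (ϑ * μ) ^ 2 ≤ S ^ 2 := by
    rw [hS]
    gcongr
  have hnorm : ‖(ϑ * μ) • u + μ • v‖ ^ 2 = μ ^ 2 * ‖ϑ • u + v‖ ^ 2 := by
    rw [mul_comm ϑ μ, mul_smul, ← smul_add, norm_smul, mul_pow, Real.norm_eq_abs, sq_abs]
  have hlow := le_quadratic_part (ϑ * μ) u (μ • v)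
  have hupp := quadratic_part_le (ϑ * μ) u (μ • v)
  rw [hnorm, real_inner_smul_right, norm_smul, mul_pow ‖μ‖, Real.norm_eq_abs, sq_abs] at hlow hupp
  set Q := (ϑ * μ + 1 / 2) * ‖u‖ ^ 2 + μ ^ 2 * ‖ϑ • u + v‖ ^ 2 + μ * ⟪u, v⟫
  set E := ‖u‖ ^ 2 + μ ^ 2 * ‖v‖ ^ 2
  have hE0 : 0 ≤ E := by positivity
  have hμa : 0 ≤ μ * a := by positivity
  have hμp : 0 ≤ μ * p := by positivity
  have hQ0 : 0 ≤ Q := nonneg_of_mul_nonneg_right (hE0.trans hlow) (by positivity)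
  constructor
  · set c := min (min 1 (2 * κ)) (1 / (16 * (1 + S ^ 2)))
    have hca : c * (μ * a) ≤ 1 * (μ * a) := by
      gcongr
      exact (min_le_left _ _).trans (min_le_left _ _)
    have hcp : c * (μ * p) ≤ 2 * κ * (μ * p) := by
      gcongr
      exact (min_le_left _ _).trans (min_le_right _ _)
    have hcE : c * E ≤ Q := calc
      c * E ≤ 1 / (16 * (1 + S ^ 2)) * E := by
        gcongr
        exact min_le_right _ _
      _ ≤ 1 / (16 * (1 + S ^ 2)) * (16 * (1 + S ^ 2) * Q) := by
        gcongr
        exact hlow.trans (by gcongr)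
      _ = Q := by field_simp
    linear_combination hca + hcp + hcE + hm₁
  · have hQE : Q ≤ 3 * (1 + S ^ 2) * E := hupp.trans (by gcongr)
    have hμd : c₀ * μ * d₀ ≤ c₀ * μbar * d₀ := by gcongr
    set A := 3 * (1 + S ^ 2)
    have hA0 : 0 ≤ A := by positivity
    set D := 2 * c₀ * μbar * d₀
    have hD0 : 0 ≤ D := by positivity
    have hAa : 0 ≤ (A + 2 * c₀ + D) * (μ * a) := by positivity
    have hAp : 0 ≤ (1 + A + D) * (μ * p) := by positivity
    have hAE : 0 ≤ (1 + 2 * c₀ + D) * E := by positivity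
    linear_combination hQE + 2 * hμd + hAa + hAp + hAE + hm₂ + hA0 + 2 * hc₀.le
end
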